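/- Assume A has full column rank. If φ : [0,1] → ℝ^e is continuously differentiable, satisfies φ'(ε) = −[D²_{φφ}Φ(φ(ε), ε)]⁻¹ · ∂_ε∇_φΦ(φ(ε), ε) for all ε ∈ [0,1], and ∇_φΦ(φ(0), 0) = 0, then ∇_φΦ(φ(ε), ε) = 0 for every ε ∈ [0,1]; that is, a solution of the ODE starting from a critical point of Φ(·, 0) remains, for each ε, the (unique) critical point of Φ(·, ε). -/

import Mathlib

open Matrix

/-- A Gram matrix with positive weights is positive definite if the factor has full column rank. -/
theorem posDef_transpose_mul_diagonal_mul {m n : Type*} [Fintype m] [Fintype n] [DecidableEq m]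
    {A : Matrix m n ℝ} (hA : A.rank = Fintype.card n) {w : m → ℝ} (hw : ∀ i, 0 < w i) :
    (Aᵀ * Matrix.diagonal w * A).PosDef := by
  have hinj : Function.Injective A.mulVec := by
    rw [Matrix.mulVec_injective_iff, linearIndependent_iff_card_eq_finrank_span,
      ← hA, Matrix.rank_eq_finrank_span_cols]
    rfl
  simpa only [Matrix.conjTranspose_eq_transpose_of_trivial] using
    (Matrix.PosDef.diagonal hw).conjTranspose_mul_mul_same hinj

/-- If `A` has full column rank and `φ : [0,1] → ℝ^e` is a `C¹` solution of the ODE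
`φ'(ε) = −[D²_{φφ}Φ(φ(ε), ε)]⁻¹ ∂_ε∇_φΦ(φ(ε), ε)` with `∇_φΦ(φ(0), 0) = 0`, then
`∇_φΦ(φ(ε), ε) = 0` for every `ε ∈ [0,1]`.  Here `G`, `H`, `E` are the gradient of `Φ` in
`φ`, its Hessian in `φ`, and the `ε`-derivative of the gradient, given in closed form. -/
theorem stmt_5
    (η : ℝ) (hη : 0 < η) (m e : ℕ) (hm : 0 < m) (he : 0 < e)
    (A : Matrix (Fin m) (Fin e) ℝ) (b : Fin e → ℝ) (c : Fin m → ℝ)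
    (μ : Fin m → ℝ) (hμ : ∀ ℓ, 0 < μ ℓ)
    (Φ : (Fin e → ℝ) → ℝ → ℝ)
    (hΦ : ∀ φ ε, Φ φ ε =
      -(∑ j, b j * φ j) + η * ∑ ℓ, Real.exp ((∑ j, A ℓ j * φ j - ε * c ℓ) / η) * μ ℓ)
    (G : (Fin e → ℝ) → ℝ → (Fin e → ℝ))
    (hG : ∀ φ ε, G φ ε = fun j =>
      -(b j) + ∑ ℓ, A ℓ j * (Real.exp ((∑ j', A ℓ j' * φ j' - ε * c ℓ) / η) * μ ℓ))
    (H : (Fin e → ℝ) → ℝ → Matrix (Fin e) (Fin e) ℝ)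
    (hH : ∀ φ ε, H φ ε = (1 / η) •
      (Aᵀ * Matrix.diagonal (fun ℓ => Real.exp ((∑ j, A ℓ j * φ j - ε * c ℓ) / η) * μ ℓ) * A))
    (E : (Fin e → ℝ) → ℝ → (Fin e → ℝ))
    (hE : ∀ φ ε, E φ ε = fun j =>
      -(1 / η) * ∑ ℓ, c ℓ * A ℓ j * (Real.exp ((∑ j', A ℓ j' * φ j' - ε * c ℓ) / η) * μ ℓ))
    (hrank : A.rank = e)
    (φ : ℝ → (Fin e → ℝ))
    (hC1 : ContDiffOn ℝ 1 φ (Set.Icc 0 1))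
    (hode : ∀ ε ∈ Set.Icc (0 : ℝ) 1, HasDerivAt φ (-((H (φ ε) ε)⁻¹ *ᵥ E (φ ε) ε)) ε)
    (hinit : G (φ 0) 0 = 0) :
    ∀ ε ∈ Set.Icc (0 : ℝ) 1, G (φ ε) ε = 0 := by
  let w : ℝ → Fin m → ℝ := fun ε ℓ =>
    Real.exp ((∑ j, A ℓ j * φ ε j - ε * c ℓ) / η) * μ ℓ
  have hw : ∀ ε ℓ, 0 < w ε ℓ := fun ε ℓ => mul_pos (Real.exp_pos _) (hμ ℓ)
  have hdet : ∀ ε, IsUnit (H (φ ε) ε).det := by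
    intro ε
    rw [hH, ← Matrix.isUnit_iff_isUnit_det]
    exact ((posDef_transpose_mul_diagonal_mul (by simpa using hrank) (hw ε)).smul
      (one_div_pos.mpr hη)).isUnit
  have hderiv : ∀ ε ∈ Set.Icc (0 : ℝ) 1, HasDerivAt (fun t => G (φ t) t) 0 ε := by
    intro ε hε
    have hφ := hode ε hε
    set v := -((H (φ ε) ε)⁻¹ *ᵥ E (φ ε) ε) with hv
    have hHv : H (φ ε) ε *ᵥ v + E (φ ε) ε = 0 := by
      rw [hv, Matrix.mulVec_neg, Matrix.mulVec_mulVec, Matrix.mul_nonsing_inv _ (hdet ε),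
        Matrix.one_mulVec, neg_add_cancel]
    have hφ' := hasDerivAt_pi.mp hφ
    have hexp : ∀ ℓ, HasDerivAt (fun t => w t ℓ)
        (w ε ℓ * ((∑ j, A ℓ j * v j - c ℓ) / η)) ε := by
      intro ℓ
      have hlin : HasDerivAt (fun t => (∑ j, A ℓ j * φ t j - t * c ℓ) / η)
          ((∑ j, A ℓ j * v j - 1 * c ℓ) / η) ε :=
        ((HasDerivAt.fun_sum fun j _ => (hφ' j).const_mul (A ℓ j)).sub
          ((hasDerivAt_id ε).mul_const (c ℓ))).div_const η
      refine (hlin.exp.mul_const (μ ℓ)).congr_deriv ?_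
      simp only [w]
      ring
    rw [hasDerivAt_pi]
    intro j
    have hsum : HasDerivAt (fun t => -(b j) + ∑ ℓ, A ℓ j * w t ℓ)
        (∑ ℓ, A ℓ j * (w ε ℓ * ((∑ j, A ℓ j * v j - c ℓ) / η))) ε :=
      (HasDerivAt.fun_sum fun ℓ _ => (hexp ℓ).const_mul (A ℓ j)).const_add _
    have hzero : ∑ ℓ, A ℓ j * (w ε ℓ * ((∑ j, A ℓ j * v j - c ℓ) / η)) = 0 := by
      have hj := congrFun hHv j
      rw [hH, hE, Matrix.smul_mulVec, ← Matrix.mulVec_mulVec, ← Matrix.mulVec_mulVec] at hj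
      simp only [Pi.add_apply, Pi.smul_apply, Pi.zero_apply, smul_eq_mul] at hj
      rw [← hj, Matrix.mulVec, dotProduct, Finset.mul_sum, Finset.mul_sum,
        ← Finset.sum_add_distrib]
      refine Finset.sum_congr rfl fun ℓ _ => ?_
      rw [Matrix.mulVec_diagonal, Matrix.transpose_apply, Matrix.mulVec, dotProduct]
      simp only [w]
      ring
    rw [hzero] at hsum
    simp only [hG]
    exact hsum
  intro ε hε
  rw [← hinit]
  exact constant_of_has_deriv_right_zero
    (fun t ht => (hderiv t ht).continuousAt.continuousWithinAt)
    (fun t ht => (hderiv t (Set.Ico_subset_Icc_self ht)).hasDerivWithinAt) ε hε
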